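/- Two-gap case along the Ostrowski ladder: for every m ≥ 0, every integer b with 1 ≤ b ≤ a_{m+1}, and N = b·q_m + q_{m-1} with N ≥ 2, the gaps of P_N comprise exactly q_m gaps of length K_{m-1} - (b-1)·K_m and exactly (b-1)·q_m + q_{m-1} gaps of length K_m; in particular the gaps take at most two distinct values. -/

import Mathlib

open Finset Filter

/-- The first `N` points of the Kronecker sequence: `P_N = {{n z} : 0 ≤ n ≤ N - 1}`. -/
noncomputable def kroneckerPts (z : ℝ) (N : ℕ) : Finset ℝ :=
  (Finset.range N).image fun n : ℕ => Int.fract ((n : ℝ) * z)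

open Classical in
/-- The gap of the finite set `S ⊆ [0,1)` at the point `x`: the distance to the next point
of `S` to the right of `x`, with the wrap-around gap `1 - x` at the rightmost point
(note that `0 ∈ kroneckerPts z N`, so this is the arc length to the next point on `ℝ/ℤ`). -/
noncomputable def gapOf (S : Finset ℝ) (x : ℝ) : ℝ :=
  if h : (S.filter fun y => x < y).Nonempty then (S.filter fun y => x < y).min' h - x
  else 1 - x

open Classical in
/-- The set of distinct gap lengths of `S`. -/
noncomputable def gapValues (S : Finset ℝ) : Finset ℝ :=
  S.image (gapOf S)

open Classical in
/-- The number of gaps of `S` having length `L`. -/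
noncomputable def gapCount (S : Finset ℝ) (L : ℝ) : ℕ :=
  (S.filter fun x => gapOf S x = L).card

/-- Two positive solutions of a linear recurrence with nonnegative coefficients have a ratio
that is bounded away from zero. -/
theorem not_tendsto_div_zero_of_recurrence (A x y : ℕ → ℝ) (hA : ∀ k, 0 ≤ A k)
    (hx : ∀ k, x (k + 2) = A k * x (k + 1) + x k)
    (hy : ∀ k, y (k + 2) = A k * y (k + 1) + y k)
    (hx0 : 0 < x 0) (hx1 : 0 < x 1) (hy0 : 0 < y 0) (hy1 : 0 < y 1) :
    ¬ Tendsto (fun k => x k / y k) atTop (nhds 0) := by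
  intro h
  have hc : 0 < min (x 0 / y 0) (x 1 / y 1) := lt_min (div_pos hx0 hy0) (div_pos hx1 hy1)
  set c := min (x 0 / y 0) (x 1 / y 1)
  have key : ∀ k, (0 < y k ∧ c * y k ≤ x k) ∧ 0 < y (k + 1) ∧ c * y (k + 1) ≤ x (k + 1) := by
    intro k
    induction k with
    | zero =>
      exact ⟨⟨hy0, (le_div_iff₀ hy0).1 (min_le_left _ _)⟩, hy1,
        (le_div_iff₀ hy1).1 (min_le_right _ _)⟩
    | succ k ih =>
      obtain ⟨⟨h1, h2⟩, h3, h4⟩ := ih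
      refine ⟨⟨h3, h4⟩, ?_, ?_⟩
      · rw [hy]
        have := mul_nonneg (hA k) h3.le
        linarith
      · rw [hx, hy]
        have := mul_le_mul_of_nonneg_left h4 (hA k)
        linarith
  have := ge_of_tendsto' h fun k => (le_div_iff₀ (key k).1.1).2 (key k).1.2
  linarith

/-- A description of `gapOf S x` by the position of the next point. -/
theorem gapOf_eq_of_forall_not_between {S : Finset ℝ} {x d : ℝ} (hd : 0 < d)
    (hS : ∀ y ∈ S, y < 1) (hnext : x + d ∈ S ∨ x + d = 1)
    (hbetween : ∀ y ∈ S, x < y → x + d ≤ y) : gapOf S x = d := by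
  classical
  unfold gapOf
  rcases hnext with h | h
  · have hmem : x + d ∈ S.filter fun y => x < y := by simp [h, hd]
    rw [dif_pos ⟨_, hmem⟩]
    have : (S.filter fun y => x < y).min' ⟨_, hmem⟩ = x + d := by
      apply le_antisymm (Finset.min'_le _ _ hmem)
      apply Finset.le_min'
      intro y hy
      rw [Finset.mem_filter] at hy
      exact hbetween y hy.1 hy.2
    rw [this, add_sub_cancel_left]
  · rw [dif_neg]
    · linarith
    · rintro ⟨y, hy⟩
      rw [Finset.mem_filter] at hy
      linarith [hS y hy.1, hbetween y hy.1 hy.2]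

/-- If `u z - P > 0` and `Q - v z > 0` with `u Q - v P = 1`, then no point of the orbit of length
`u + v` lies strictly between `n z` and its natural successor on the circle. -/
theorem not_between_of_unimodular {z : ℝ} {u v P Q : ℤ} (hu : 0 < u) (hv : 0 < v)
    (hdet : u * Q - v * P = 1) (hα : 0 < u * z - P) (hβ : 0 < Q - v * z)
    {n n' : ℤ} (hn0 : 0 ≤ n) (hn : n < u + v) (hn0' : 0 ≤ n') (hn' : n' < u + v) (l : ℤ)
    (hlt : n * z < n' * z - l) :
    n * z + (if n < v then u * z - P else Q - v * z) ≤ n' * z - l := by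
  by_contra! hcon
  obtain ⟨i, j, hi, hj⟩ : ∃ i j : ℤ, n' - n = i * u + j * v ∧ l = i * P + j * Q :=
    ⟨(n' - n) * Q - l * v, l * u - (n' - n) * P,
      by linear_combination (-(n' - n)) * hdet, by linear_combination (-l) * hdet⟩
  have hkz : (n' : ℝ) * z - l - n * z = i * (u * z - P) - j * (Q - v * z) := by
    have h1 : (n' : ℝ) - n = i * u + j * v := by exact_mod_cast hi
    have h2 : (l : ℝ) = i * P + j * Q := by exact_mod_cast hj
    linear_combination z * h1 - h2
  set α := (u : ℝ) * z - P
  set β := (Q : ℝ) - v * z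
  have hpos : (0 : ℝ) < i * α - j * β := by linarith
  split_ifs at hcon with hnv
  · have hlt' : (i : ℝ) * α - j * β < α := by linarith
    rcases lt_trichotomy j 0 with h | rfl | h
    · have h' : (j : ℝ) ≤ -1 := by exact_mod_cast (by omega : j ≤ -1)
      have hi0 : i < 1 := by
        by_contra! hc
        have hc' : (1 : ℝ) ≤ i := by exact_mod_cast hc
        nlinarith
      nlinarith
    · have h1 : (0 : ℝ) < i := by
        by_contra! hc
        norm_num at hpos
        nlinarith
      have h2 : (i : ℝ) < 1 := by
        by_contra! hc
        norm_num at hlt'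
        nlinarith
      have h1' : (0 : ℤ) < i := by exact_mod_cast h1
      have h2' : i < (1 : ℤ) := by exact_mod_cast h2
      omega
    · have h' : (1 : ℝ) ≤ j := by exact_mod_cast h
      have hi0 : 0 < i := by
        by_contra! hc
        have hc' : (i : ℝ) ≤ 0 := by exact_mod_cast hc
        nlinarith
      nlinarith
  · have hlt' : (i : ℝ) * α - j * β < β := by linarith
    rcases lt_or_ge j 0 with h | h
    · have h' : (j : ℝ) ≤ -1 := by exact_mod_cast (by omega : j ≤ -1)
      have hi0 : i < 0 := by
        by_contra! hc
        have hc' : (0 : ℝ) ≤ i := by exact_mod_cast hc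
        nlinarith
      nlinarith
    · have h' : (0 : ℝ) ≤ j := by exact_mod_cast h
      have hi0 : 0 < i := by
        by_contra! hc
        have hc' : (i : ℝ) ≤ 0 := by exact_mod_cast hc
        nlinarith
      nlinarith

/-- The gap of the Kronecker set of size `u + v` at the point `{n z}`. -/
theorem gapOf_kroneckerPts_of_unimodular {z : ℝ} {u v N : ℕ} {P Q : ℤ} (hu : 0 < u) (hv : 0 < v)
    (hN : N = u + v) (hdet : u * Q - v * P = 1) (hα : 0 < u * z - P) (hβ : 0 < Q - v * z)
    {n : ℕ} (hn : n < N) :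
    gapOf (kroneckerPts z N) (Int.fract (n * z)) = if n < v then u * z - P else Q - v * z := by
  subst hN
  have hbetween : ∀ k : ℕ, k < u + v → ∀ l : ℤ, (n : ℝ) * z < k * z - l →
      (n : ℝ) * z + (if n < v then u * z - P else Q - v * z) ≤ k * z - l := by
    intro k hk l hl
    have := not_between_of_unimodular (z := z) (u := u) (v := v) (n := n) (n' := k)
      (by exact_mod_cast hu) (by exact_mod_cast hv) hdet (by exact_mod_cast hα)
      (by exact_mod_cast hβ) (by positivity) (by exact_mod_cast hn) (by positivity)
      (by exact_mod_cast hk) l (by exact_mod_cast hl)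
    exact_mod_cast this
  obtain ⟨k, hk, l, hl⟩ : ∃ k : ℕ, k < u + v ∧ ∃ l : ℤ,
      (n : ℝ) * z + (if n < v then u * z - P else Q - v * z) = k * z - l := by
    split_ifs with h
    · exact ⟨n + u, by omega, P, by push_cast; ring⟩
    · refine ⟨n - v, by omega, -Q, ?_⟩
      rw [Nat.cast_sub (by omega)]
      push_cast
      ring
  have hd : 0 < (if n < v then u * z - P else Q - v * z) := by split_ifs <;> assumption
  set d := (if n < v then u * z - P else Q - v * z)
  have hle : Int.fract ((n : ℝ) * z) + d ≤ 1 := by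
    have h1 := Int.fract_lt_one ((n : ℝ) * z)
    have h2 := Int.floor_add_fract ((n : ℝ) * z)
    have := hbetween 0 (by omega) (-(⌊(n : ℝ) * z⌋ + 1)) (by push_cast; linarith)
    push_cast at this
    linarith
  apply gapOf_eq_of_forall_not_between hd
  · intro y hy
    obtain ⟨k, -, rfl⟩ := Finset.mem_image.1 hy
    exact Int.fract_lt_one _
  · rcases hle.lt_or_eq with h | h
    · left
      refine Finset.mem_image.2 ⟨k, Finset.mem_range.2 hk, ?_⟩
      refine Int.fract_eq_iff.2 ⟨by linarith [Int.fract_nonneg ((n : ℝ) * z)], h,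
        l + ⌊(n : ℝ) * z⌋, ?_⟩
      have h2 := Int.floor_add_fract ((n : ℝ) * z)
      push_cast
      linarith
    · exact Or.inr h
  · intro y hy hxy
    obtain ⟨k, hk, rfl⟩ := Finset.mem_image.1 hy
    have h2 := Int.floor_add_fract ((n : ℝ) * z)
    have h3 := Int.floor_add_fract ((k : ℝ) * z)
    have := hbetween k (Finset.mem_range.1 hk) (⌊(k : ℝ) * z⌋ - ⌊(n : ℝ) * z⌋)
      (by push_cast; linarith)
    push_cast at this
    linarith

/-- The points `{n z}` of an irrational rotation are distinct. -/
theorem injective_fract_natCast_mul {z : ℝ} (hz : Irrational z) :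
    Function.Injective fun n : ℕ => Int.fract ((n : ℝ) * z) := by
  intro n k h
  obtain ⟨l, hl⟩ := Int.fract_eq_fract.1 h
  by_contra hne
  have hne' : (n : ℤ) - k ≠ 0 := by omega
  apply (hz.intCast_mul hne').ne_int l
  push_cast
  linarith

/-- The gap statistics of the Kronecker set of size `u + v` for a unimodular pair. -/
theorem gap_statistics_of_unimodular {z : ℝ} (hz : Irrational z) {u v N : ℕ} {P Q : ℤ}
    (hu : 0 < u) (hv : 0 < v) (hN : N = u + v) (hdet : u * Q - v * P = 1)
    (hα : 0 < u * z - P) (hβ : 0 < Q - v * z) :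
    gapCount (kroneckerPts z N) (u * z - P) = v ∧
    gapCount (kroneckerPts z N) (Q - v * z) = u ∧
    (gapValues (kroneckerPts z N)).card ≤ 2 := by
  classical
  have hgap : ∀ n < N, gapOf (kroneckerPts z N) (Int.fract (n * z)) =
      if n < v then u * z - P else Q - v * z :=
    fun n hn => gapOf_kroneckerPts_of_unimodular hu hv hN hdet hα hβ hn
  have hne : (u : ℝ) * z - P ≠ Q - v * z := by
    intro h
    have h0 : (u : ℤ) + v ≠ 0 := by omega
    apply (hz.intCast_mul h0).ne_int (P + Q)
    push_cast
    linarith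
  have hcount : ∀ L, gapCount (kroneckerPts z N) L =
      ((Finset.range N).filter fun n => (if n < v then u * z - P else Q - v * z) = L).card := by
    intro L
    unfold gapCount
    conv_lhs => enter [1, 2]; rw [kroneckerPts]
    rw [Finset.filter_image, Finset.card_image_of_injective _ (injective_fract_natCast_mul hz)]
    congr 1
    apply Finset.filter_congr
    intro n hn
    rw [hgap n (Finset.mem_range.1 hn)]
  refine ⟨?_, ?_, ?_⟩
  · rw [hcount]
    have : ((Finset.range N).filter fun n : ℕ =>
        (if n < v then (u : ℝ) * z - P else Q - v * z) = u * z - P) = Finset.range v := by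
      ext n
      by_cases h : n < v
      · simp [h]; omega
      · simp [h, hne.symm]
    rw [this, Finset.card_range]
  · rw [hcount]
    have : ((Finset.range N).filter fun n : ℕ =>
        (if n < v then (u : ℝ) * z - P else Q - v * z) = Q - v * z) = Finset.Ico v N := by
      ext n
      by_cases h : n < v
      · simp [hne]; omega
      · simp [h]; omega
    rw [this, Nat.card_Ico]
    omega
  · refine (Finset.card_le_card (t := {(u : ℝ) * z - P, Q - v * z}) ?_).trans Finset.card_le_two
    intro y hy
    obtain ⟨x, hx, rfl⟩ := Finset.mem_image.1 hy
    obtain ⟨n, hn, rfl⟩ := Finset.mem_image.1 hx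
    rw [hgap n (Finset.mem_range.1 hn)]
    split_ifs <;> simp

/-- **Two-gap case along the Ostrowski ladder.** For every `m ≥ 0`, every integer `b`
with `1 ≤ b ≤ a_{m+1}` and `N = b q_m + q_{m-1}` with `N ≥ 2`, the gaps of `P_N`
comprise exactly `q_m` gaps of length `K_{m-1} - (b-1) K_m` and exactly
`(b-1) q_m + q_{m-1}` gaps of length `K_m`; in particular there are at most two
distinct gap lengths. -/
theorem two_gap_ostrowski_ladder
    (z : ℝ) (hirr : Irrational z) (hz0 : 0 < z) (hz1 : z < 1)
    (a p q : ℤ → ℤ)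
    (ha0 : a 0 = 0) (ha : ∀ n : ℤ, 1 ≤ n → 1 ≤ a n)
    (hp2 : p (-2) = 0) (hp1 : p (-1) = 1)
    (hq2 : q (-2) = 1) (hq1 : q (-1) = 0)
    (hp : ∀ n : ℤ, 0 ≤ n → p n = a n * p (n - 1) + p (n - 2))
    (hq : ∀ n : ℤ, 0 ≤ n → q n = a n * q (n - 1) + q (n - 2))
    (hconv : Tendsto (fun n : ℕ => (p n : ℝ) / (q n : ℝ)) atTop (nhds z))
    (K : ℤ → ℝ) (hK : ∀ n : ℤ, -1 ≤ n → K n = |(q n : ℝ) * z - (p n : ℝ)|)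
    (m : ℕ) (b : ℤ) (hb1 : 1 ≤ b) (hba : b ≤ a (m + 1))
    (N : ℕ) (hN2 : 2 ≤ N) (hN : (N : ℤ) = b * q m + q ((m : ℤ) - 1)) :
    (gapCount (kroneckerPts z N) (K ((m : ℤ) - 1) - ((b : ℝ) - 1) * K m) : ℤ) = q m ∧
    (gapCount (kroneckerPts z N) (K m) : ℤ) = (b - 1) * q m + q ((m : ℤ) - 1) ∧
    (gapValues (kroneckerPts z N)).card ≤ 2 := by
  have hq0 : q 0 = 1 := by simpa [ha0, hq2] using hq 0 le_rfl
  have hp0 : p 0 = 0 := by simpa [ha0, hp2] using hp 0 le_rfl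
  have hqs : ∀ n : ℕ, q (n + 1) = a (n + 1) * q n + q ((n : ℤ) - 1) := by
    intro n
    rw [hq (n + 1) (by positivity), add_sub_cancel_right, show (n : ℤ) + 1 - 2 = n - 1 by ring]
  have hps : ∀ n : ℕ, p (n + 1) = a (n + 1) * p n + p ((n : ℤ) - 1) := by
    intro n
    rw [hp (n + 1) (by positivity), add_sub_cancel_right, show (n : ℤ) + 1 - 2 = n - 1 by ring]
  have hqpos : ∀ n : ℕ, 0 < q n ∧ 0 ≤ q ((n : ℤ) - 1) := by
    intro n
    induction n with
    | zero => simp [hq0, hq1]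
    | succ n ih =>
      push_cast
      rw [add_sub_cancel_right, hqs]
      exact ⟨by nlinarith [ha (n + 1) (by omega)], ih.1.le⟩
  have hdet : ∀ n : ℕ, q n * p ((n : ℤ) - 1) - p n * q ((n : ℤ) - 1) = (-1) ^ n := by
    intro n
    induction n with
    | zero => simp [hq0, hp0, hp1]
    | succ n ih =>
      push_cast
      rw [add_sub_cancel_right, hqs, hps, pow_succ]
      linear_combination -ih
  set D : ℤ → ℝ := fun n => q n * z - p n with hD
  have hDs : ∀ n : ℕ, D (n + 1) = a (n + 1) * D n + D ((n : ℤ) - 1) := by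
    intro n
    simp only [hD, hqs, hps]
    push_cast
    ring
  have hDne : ∀ n : ℕ, D n ≠ 0 := by
    intro n h
    exact (hirr.intCast_mul (hqpos n).1.ne').ne_int (p n) (sub_eq_zero.1 h)
  have hlim : Tendsto (fun n : ℕ => D n / q n) atTop (nhds 0) := by
    have h := (tendsto_const_nhds (x := z)).sub hconv
    rw [sub_self] at h
    refine h.congr fun n => ?_
    have : (q n : ℝ) ≠ 0 := by exact_mod_cast (hqpos n).1.ne'
    simp only [hD]
    field_simp
  have hsame : ∀ (s : ℝ) (n : ℕ), 0 < s * D n → ¬ 0 < s * D (n + 1) := by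
    intro s n h0 h1
    have hshift := (((tendsto_add_atTop_iff_nat n).2 hlim).const_mul s)
    rw [mul_zero] at hshift
    refine not_tendsto_div_zero_of_recurrence (fun k => a (k + n + 2))
      (fun k => s * D ((k + n : ℕ) : ℤ)) (fun k => q ((k + n : ℕ) : ℤ))
      ?_ ?_ ?_ ?_ ?_ ?_ ?_ (hshift.congr fun k => ?_)
    · intro k
      exact_mod_cast (zero_le_one.trans (ha (k + n + 2) (by omega)))
    · intro k
      have := hDs (k + n + 1)
      push_cast at this ⊢
      rw [show (k : ℤ) + 2 + n = k + n + 1 + 1 by ring, show (k : ℤ) + 1 + n = k + n + 1 by ring,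
        show (k : ℤ) + n + 2 = k + n + 1 + 1 by ring, this, add_sub_cancel_right]
      ring
    · intro k
      have := hqs (k + n + 1)
      push_cast at this ⊢
      rw [show (k : ℤ) + 2 + n = k + n + 1 + 1 by ring, show (k : ℤ) + 1 + n = k + n + 1 by ring,
        show (k : ℤ) + n + 2 = k + n + 1 + 1 by ring, this, add_sub_cancel_right]
      push_cast
      ring
    · simpa using h0
    · simpa [add_comm] using h1
    · exact_mod_cast (hqpos _).1
    · exact_mod_cast (hqpos _).1
    · ring
  have hsign : ∀ n : ℕ, 0 < (-1) ^ n * D n ∧ (-1) ^ n * D ((n : ℤ) - 1) < 0 := by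
    intro n
    induction n with
    | zero => simp [hD, hq0, hp0, hq1, hp1, hz0]
    | succ n ih =>
      have h := hsame _ _ ih.1
      have hne : (-1 : ℝ) ^ n * D (n + 1) ≠ 0 :=
        mul_ne_zero (pow_ne_zero _ (by norm_num)) (by exact_mod_cast hDne (n + 1))
      have hlt := lt_of_le_of_ne (not_lt.1 h) hne
      push_cast
      rw [add_sub_cancel_right, pow_succ]
      exact ⟨by linarith, by linarith [ih.1]⟩
  have hKm : K m = |D m| := hK m (by omega)
  have hKm1 : K ((m : ℤ) - 1) = |D ((m : ℤ) - 1)| := hK _ (by omega)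
  have hnext := (hsign (m + 1)).1
  push_cast at hnext
  rw [hDs, pow_succ] at hnext
  obtain ⟨hs1, hs2⟩ := hsign m
  have hbaR : (b : ℝ) ≤ a (m + 1) := by exact_mod_cast hba
  obtain ⟨u, hu⟩ := Int.eq_ofNat_of_zero_le (hqpos m).1.le
  have hu0 : 0 < u := by have := (hqpos m).1; omega
  have hv0 : 0 < (b - 1) * q m + q ((m : ℤ) - 1) := by
    rcases hb1.lt_or_eq with h | rfl
    · nlinarith [hqpos m]
    · rcases Nat.eq_zero_or_pos m with rfl | hm
      · simp [hq0, hq1] at hN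
        omega
      · have := (hqpos (m - 1)).1
        rw [Nat.cast_sub hm] at this
        simpa using this
  obtain ⟨v, hv⟩ := Int.eq_ofNat_of_zero_le hv0.le
  have hvR : (v : ℝ) = (b - 1) * q m + q ((m : ℤ) - 1) := by exact_mod_cast hv.symm
  have huR : (u : ℝ) = q m := by exact_mod_cast hu.symm
  have hNuv : N = u + v := by
    have : (N : ℤ) = u + v := by rw [hN, ← hu, ← hv]; ring
    exact_mod_cast this
  have hdm := hdet m
  rw [hv, hu]
  rcases Nat.even_or_odd m with hm | hm
  · rw [hm.neg_one_pow] at hs1 hs2 hnext hdm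
    rw [abs_of_pos (by linarith)] at hKm
    rw [abs_of_neg (by linarith)] at hKm1
    have hα : K m = u * z - p m := by rw [hKm, huR]
    have hβ : K ((m : ℤ) - 1) - ((b : ℝ) - 1) * K m =
        ((p ((m : ℤ) - 1) + (b - 1) * p m : ℤ) : ℝ) - v * z := by
      rw [hKm, hKm1, hvR]
      simp only [hD]
      push_cast
      ring
    obtain ⟨h1, h2, h3⟩ := gap_statistics_of_unimodular hirr hu0 (by omega : 0 < v) hNuv
      (P := p m) (Q := p ((m : ℤ) - 1) + (b - 1) * p m)
      (by rw [← hu, ← hv]; linear_combination hdm) (by rw [← hα]; linarith)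
      (by rw [← hβ, hKm, hKm1]; nlinarith)
    rw [hβ, hα, h1, h2]
    exact ⟨rfl, rfl, h3⟩
  · rw [hm.neg_one_pow] at hs1 hs2 hnext hdm
    rw [abs_of_neg (by linarith)] at hKm
    rw [abs_of_pos (by linarith)] at hKm1
    have hα : K m = p m - u * z := by rw [hKm, huR]; simp only [hD]; ring
    have hβ : K ((m : ℤ) - 1) - ((b : ℝ) - 1) * K m =
        v * z - ((p ((m : ℤ) - 1) + (b - 1) * p m : ℤ) : ℝ) := by
      rw [hKm, hKm1, hvR]
      simp only [hD]
      push_cast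
      ring
    obtain ⟨h1, h2, h3⟩ := gap_statistics_of_unimodular hirr (by omega : 0 < v) hu0
      (hNuv.trans (add_comm _ _)) (P := p ((m : ℤ) - 1) + (b - 1) * p m) (Q := p m)
      (by rw [← hu, ← hv]; linear_combination -hdm) (by rw [← hβ, hKm, hKm1]; nlinarith)
      (by rw [← hα]; linarith)
    rw [hβ, hα, h1, h2]
    exact ⟨rfl, rfl, h3⟩
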